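/- arXiv:2511.06477 — 5 statements merged into one kernel-verified Lean document; each statement's English description precedes it below -/
import Mathlib

section
/- Let G_1, ..., G_t be real m×n matrices and let g_i = vec(G_i) ∈ ℝ^{mn} denote their vectorizations. Suppose μ ∈ [0,1] satisfies |⟨g_i, g_j⟩| ≤ μ‖g_i‖‖g_j‖ for all i ≠ j. Let L = Σ_{i=1}^t G_i G_iᵀ, R = Σ_{i=1}^t G_iᵀ G_i, and F = Σ_{i=1}^t g_i g_iᵀ. Then ‖L^{1/2} ⊗ R^{1/2}‖_F² − ‖F‖_F² ≥ (1 − μ²) · Σ_{i=1}^t Σ_{j≠i} ‖G_i‖_F² ‖G_j‖_F², where L^{1/2} and R^{1/2} denote the positive semidefinite square roots of L and R. -/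
open Matrix Kronecker BigOperators

/-- The Frobenius norm of a real matrix. -/
noncomputable def frobNorm {m n : Type*} [Fintype m] [Fintype n] (A : Matrix m n ℝ) : ℝ :=
  Real.sqrt (∑ i, ∑ j, A i j ^ 2)

lemma frob_sq_aux {m n : Type*} [Fintype m] [Fintype n] (A : Matrix m n ℝ) :
    frobNorm A ^ 2 = ∑ i, ∑ j, A i j ^ 2 := by
  unfold frobNorm
  exact Real.sq_sqrt (Finset.sum_nonneg fun i _ => Finset.sum_nonneg fun j _ => sq_nonneg _)

lemma frob_sym_aux {m : Type*} [Fintype m] (S : Matrix m m ℝ) (hS : S.PosSemidef) :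
    ∑ i, ∑ j, S i j ^ 2 = (S * S).trace := by
  simp only [Matrix.trace, Matrix.diag, Matrix.mul_apply]
  refine Finset.sum_congr rfl fun i _ => Finset.sum_congr rfl fun j _ => ?_
  have h := hS.1.apply i j
  simp only [star_trivial] at h
  rw [h, sq]

lemma frob_kron_aux {m n : Type*} [Fintype m] [Fintype n] (A : Matrix m m ℝ) (B : Matrix n n ℝ) :
    frobNorm (A ⊗ₖ B) ^ 2 = (∑ i, ∑ j, A i j ^ 2) * ∑ i, ∑ j, B i j ^ 2 := by
  rw [frob_sq_aux, Fintype.sum_prod_type, Finset.sum_mul_sum]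
  refine Finset.sum_congr rfl fun i _ => Finset.sum_congr rfl fun j _ => ?_
  rw [Fintype.sum_prod_type, Finset.sum_mul_sum]
  refine Finset.sum_congr rfl fun k _ => Finset.sum_congr rfl fun l _ => ?_
  simp only [Matrix.kroneckerMap_apply, mul_pow]

lemma frob_fisher_aux {ι p : Type*} [Fintype ι] [Fintype p] (g : ι → p → ℝ) :
    ∑ x, ∑ y, (∑ i, g i x * g i y) ^ 2 = ∑ i, ∑ j, (∑ x, g i x * g j x) ^ 2 := by
  have h1 : ∀ x y, (∑ i, g i x * g i y) ^ 2
      = ∑ i, ∑ j, (g i x * g j x) * (g i y * g j y) := by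
    intro x y
    rw [sq, Finset.sum_mul_sum]
    refine Finset.sum_congr rfl fun i _ => Finset.sum_congr rfl fun j _ => by ring
  simp only [h1, sq, Finset.sum_mul_sum]
  calc _ = ∑ x, ∑ i, ∑ y, ∑ j, (g i x * g j x) * (g i y * g j y) :=
        Finset.sum_congr rfl fun x _ => Finset.sum_comm
    _ = ∑ i, ∑ x, ∑ y, ∑ j, (g i x * g j x) * (g i y * g j y) := Finset.sum_comm
    _ = ∑ i, ∑ x, ∑ j, ∑ y, (g i x * g j x) * (g i y * g j y) :=
        Finset.sum_congr rfl fun i _ => Finset.sum_congr rfl fun x _ => Finset.sum_comm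
    _ = _ := Finset.sum_congr rfl fun i _ => Finset.sum_comm

/-- lower bound on the gap between the squared Frobenius norm of the
Shampoo Kronecker estimate `L^{1/2} ⊗ R^{1/2}` and that of the empirical Fisher
matrix `F = ∑ vec(Gᵢ) vec(Gᵢ)ᵀ`, in terms of the mutual coherence `μ` of the
vectorized gradients. -/
theorem shampoo_fisher_norm_gap {t m n : ℕ} (G : Fin t → Matrix (Fin m) (Fin n) ℝ)
    (μ : ℝ) (hμ0 : 0 ≤ μ) (hμ1 : μ ≤ 1)
    (hcoh : ∀ i j : Fin t, i ≠ j →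
      |∑ a, ∑ b, G i a b * G j a b| ≤ μ * frobNorm (G i) * frobNorm (G j))
    (L : Matrix (Fin m) (Fin m) ℝ) (hL : L = ∑ i, G i * (G i)ᵀ)
    (R : Matrix (Fin n) (Fin n) ℝ) (hR : R = ∑ i, (G i)ᵀ * G i)
    (F : Matrix (Fin m × Fin n) (Fin m × Fin n) ℝ)
    (hF : ∀ p q, F p q = ∑ i, G i p.1 p.2 * G i q.1 q.2)
    (SL : Matrix (Fin m) (Fin m) ℝ) (hSL : SL.PosSemidef) (hSL2 : SL * SL = L)
    (SR : Matrix (Fin n) (Fin n) ℝ) (hSR : SR.PosSemidef) (hSR2 : SR * SR = R) :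
    (1 - μ ^ 2) * ∑ i, ∑ j ∈ Finset.univ.filter (· ≠ i),
        frobNorm (G i) ^ 2 * frobNorm (G j) ^ 2
      ≤ frobNorm (SL ⊗ₖ SR) ^ 2 - frobNorm F ^ 2 := by
  have hLt : L.trace = ∑ i, frobNorm (G i) ^ 2 := by
    rw [hL, Matrix.trace_sum]
    refine Finset.sum_congr rfl fun i _ => ?_
    rw [frob_sq_aux]
    simp [Matrix.trace, Matrix.mul_apply, sq]
  have hRt : R.trace = ∑ i, frobNorm (G i) ^ 2 := by
    rw [← hLt, hL, hR, Matrix.trace_sum, Matrix.trace_sum]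
    exact Finset.sum_congr rfl fun i _ => Matrix.trace_mul_comm _ _
  have hK : frobNorm (SL ⊗ₖ SR) ^ 2
      = ∑ i, ∑ j, frobNorm (G i) ^ 2 * frobNorm (G j) ^ 2 := by
    rw [frob_kron_aux, frob_sym_aux SL hSL, frob_sym_aux SR hSR, hSL2, hSR2, hLt, hRt,
      Finset.sum_mul_sum]
  have hFn : frobNorm F ^ 2 = ∑ i, ∑ j, (∑ a, ∑ b, G i a b * G j a b) ^ 2 := by
    rw [frob_sq_aux]
    simp only [hF]
    rw [frob_fisher_aux (fun i (p : Fin m × Fin n) => G i p.1 p.2)]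
    simp only [Fintype.sum_prod_type]
  rw [hK, hFn, ← Finset.sum_sub_distrib, Finset.mul_sum]
  refine Finset.sum_le_sum fun i _ => ?_
  rw [← Finset.sum_sub_distrib, Finset.mul_sum, Finset.sum_filter]
  refine Finset.sum_le_sum fun j _ => ?_
  split_ifs with h
  · have h2 := pow_le_pow_left₀ (abs_nonneg _) (hcoh i j (Ne.symm h)) 2
    rw [sq_abs] at h2
    nlinarith [h2]
  · have h' : j = i := not_not.mp h
    subst h'
    have : ∑ a, ∑ b, G j a b * G j a b = frobNorm (G j) ^ 2 := by
      rw [frob_sq_aux]; simp only [sq]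
    rw [this]
    apply le_of_eq
    ring
end

section
/- Let G be a real m×n matrix, σ ≥ 0, and let u ∈ ℝ^m, v ∈ ℝ^n be unit vectors with G v = σ u, Gᵀ u = σ v, and ‖G x‖ ≤ σ ‖x‖ for every x ∈ ℝ^n (i.e., σ is the largest singular value of G with singular vectors u, v). Let M be the mn×mn matrix with entries M[(i,j),(i',j')] = G[i,j]·G[i',j'] (that is, M = vec(G)·vec(G)ᵀ). Then for every m×m matrix L and every n×n matrix R, ‖M − (σ u uᵀ) ⊗ (σ v vᵀ)‖_F ≤ ‖M − L ⊗ R‖_F. -/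
open Matrix Kronecker BigOperators

/-- The Euclidean norm of a real vector. -/
noncomputable def vnorm {ι : Type*} [Fintype ι] (x : ι → ℝ) : ℝ :=
  Real.sqrt (∑ i, x i ^ 2)

theorem aux_contract {m n k : ℕ} (G : Matrix (Fin m) (Fin n) ℝ) (σ : ℝ)
    (hmax : ∀ x : Fin n → ℝ, ∑ i, (G.mulVec x) i ^ 2 ≤ σ ^ 2 * ∑ i, x i ^ 2)
    (B : Matrix (Fin n) (Fin k) ℝ) :
    ∑ i, ∑ j, (G * B) i j ^ 2 ≤ σ ^ 2 * ∑ i, ∑ j, B i j ^ 2 := by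
  rw [Finset.sum_comm, Finset.sum_comm (f := fun i j => B i j ^ 2), Finset.mul_sum]
  exact Finset.sum_le_sum fun j _ => hmax (fun i => B i j)

theorem aux_inner {m n : ℕ} (G : Matrix (Fin m) (Fin n) ℝ)
    (A : Matrix (Fin m) (Fin m) ℝ) (B : Matrix (Fin n) (Fin n) ℝ) :
    ∑ p : Fin m × Fin n, ∑ q : Fin m × Fin n, (G p.1 p.2 * G q.1 q.2) * (A p.1 q.1 * B p.2 q.2)
      = ∑ i, ∑ k, A i k * (G * (G * B)ᵀ) k i := by
  simp only [Fintype.sum_prod_type, Matrix.mul_apply, Matrix.transpose_apply, Finset.mul_sum]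
  refine Finset.sum_congr rfl fun i _ => ?_
  rw [Finset.sum_comm]
  refine Finset.sum_congr rfl fun k _ => ?_
  rw [Finset.sum_comm]
  refine Finset.sum_congr rfl fun j _ => Finset.sum_congr rfl fun l _ => ?_
  ring

theorem aux_normsq {m n : ℕ}
    (A : Matrix (Fin m) (Fin m) ℝ) (B : Matrix (Fin n) (Fin n) ℝ) :
    ∑ p : Fin m × Fin n, ∑ q : Fin m × Fin n, (A p.1 q.1 * B p.2 q.2) ^ 2
      = (∑ i, ∑ k, A i k ^ 2) * ∑ j, ∑ l, B j l ^ 2 := by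
  simp only [Fintype.sum_prod_type, Finset.sum_mul, mul_pow]
  refine Finset.sum_congr rfl fun i _ => ?_
  rw [Finset.sum_comm]
  conv_lhs => enter [2, k]; rw [← Finset.sum_comm]
  simp only [Finset.mul_sum]
  rw [Finset.sum_comm]
  first
  | done
  | (rw [Finset.sum_comm]
     try (refine Finset.sum_congr rfl fun k _ => ?_; rw [Finset.sum_comm]))

theorem aux_expand {m n : ℕ} (G : Matrix (Fin m) (Fin n) ℝ)
    (M : Matrix (Fin m × Fin n) (Fin m × Fin n) ℝ)
    (hM : ∀ p q, M p q = G p.1 p.2 * G q.1 q.2)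
    (A : Matrix (Fin m) (Fin m) ℝ) (B : Matrix (Fin n) (Fin n) ℝ) :
    ∑ p, ∑ q, (M - A ⊗ₖ B) p q ^ 2 = ∑ p, ∑ q, M p q ^ 2
      - 2 * (∑ i, ∑ k, A i k * (G * (G * B)ᵀ) k i)
      + (∑ i, ∑ k, A i k ^ 2) * ∑ j, ∑ l, B j l ^ 2 := by
  rw [← aux_inner, ← aux_normsq]
  simp only [Finset.mul_sum, ← Finset.sum_sub_distrib, ← Finset.sum_add_distrib]
  refine Finset.sum_congr rfl fun p _ => Finset.sum_congr rfl fun q _ => ?_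
  simp only [Matrix.sub_apply, Matrix.kroneckerMap_apply, hM]
  ring

theorem aux_cs {m : ℕ} (A C : Matrix (Fin m) (Fin m) ℝ) :
    (∑ i, ∑ k, A i k * C k i) ^ 2 ≤ (∑ i, ∑ k, A i k ^ 2) * ∑ i, ∑ k, C i k ^ 2 := by
  have h := Finset.sum_mul_sq_le_sq_mul_sq Finset.univ
    (fun p : Fin m × Fin m => A p.1 p.2) (fun p => C p.2 p.1)
  simp only [Fintype.sum_prod_type] at h
  rwa [Finset.sum_comm (f := fun i k => C k i ^ 2)] at h

theorem aux_outer {m : ℕ} (σ : ℝ) (u : Fin m → ℝ) (hu : ∑ i, u i ^ 2 = 1) :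
    ∑ i, ∑ k, (σ • vecMulVec u u) i k ^ 2 = σ ^ 2 := by
  have : ∀ i k, (σ • vecMulVec u u) i k ^ 2 = σ ^ 2 * u i ^ 2 * u k ^ 2 := by
    intro i k
    simp only [Matrix.smul_apply, vecMulVec_apply, smul_eq_mul]
    ring
  simp only [this, ← Finset.mul_sum, hu, mul_one]

/-- `(σ u uᵀ) ⊗ (σ v vᵀ)`, built from the top singular triple of `G`, is a
best Kronecker-product approximation of `M = vec(G) vec(G)ᵀ` in Frobenius norm. -/
theorem best_kronecker_init {m n : ℕ} (G : Matrix (Fin m) (Fin n) ℝ)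
    (σ : ℝ) (hσ : 0 ≤ σ) (u : Fin m → ℝ) (v : Fin n → ℝ)
    (hu : vnorm u = 1) (hv : vnorm v = 1)
    (hGv : G.mulVec v = σ • u) (hGtu : Gᵀ.mulVec u = σ • v)
    (hmax : ∀ x : Fin n → ℝ, vnorm (G.mulVec x) ≤ σ * vnorm x)
    (M : Matrix (Fin m × Fin n) (Fin m × Fin n) ℝ)
    (hM : ∀ p q, M p q = G p.1 p.2 * G q.1 q.2)
    (L : Matrix (Fin m) (Fin m) ℝ) (R : Matrix (Fin n) (Fin n) ℝ) :
    frobNorm (M - (σ • vecMulVec u u) ⊗ₖ (σ • vecMulVec v v)) ≤ frobNorm (M - L ⊗ₖ R) := by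
  have hu' : ∑ i, u i ^ 2 = 1 := by simpa [vnorm] using hu
  have hv' : ∑ i, v i ^ 2 = 1 := by simpa [vnorm] using hv
  have hmax' : ∀ x : Fin n → ℝ, ∑ i, (G.mulVec x) i ^ 2 ≤ σ ^ 2 * ∑ i, x i ^ 2 := by
    intro x
    have h := pow_le_pow_left₀ (Real.sqrt_nonneg _) (hmax x) 2
    unfold vnorm at h
    rw [mul_pow, Real.sq_sqrt (by positivity), Real.sq_sqrt (by positivity)] at h
    exact h
  unfold frobNorm
  apply Real.sqrt_le_sqrt
  rw [aux_expand G M hM, aux_expand G M hM, aux_outer σ u hu', aux_outer σ v hv']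
  have hGB : G * (G * (σ • vecMulVec v v))ᵀ = σ ^ 3 • vecMulVec u u := by
    rw [Matrix.mul_smul, Matrix.mul_vecMulVec, hGv, Matrix.transpose_smul,
      Matrix.transpose_vecMulVec, Matrix.mul_smul, Matrix.mul_vecMulVec, hGv]
    ext i j
    simp only [Matrix.smul_apply, vecMulVec_apply, smul_eq_mul, Pi.smul_apply]
    ring
  have hS : ∑ i, ∑ k, (σ • vecMulVec u u) i k * (G * (G * (σ • vecMulVec v v))ᵀ) k i
      = σ ^ 4 := by
    rw [hGB]
    have : ∀ i k, (σ • vecMulVec u u) i k * (σ ^ 3 • vecMulVec u u) k i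
        = σ ^ 4 * u i ^ 2 * u k ^ 2 := by
      intro i k
      simp only [Matrix.smul_apply, vecMulVec_apply, smul_eq_mul]
      ring
    simp only [this, ← Finset.mul_sum, hu', mul_one]
  rw [hS]
  have h1 := aux_cs L (G * (G * R)ᵀ)
  have h2 := aux_contract G σ hmax' (G * R)ᵀ
  have h3 := aux_contract G σ hmax' R
  have h4 : ∑ i, ∑ j, (G * R)ᵀ i j ^ 2 = ∑ i, ∑ j, (G * R) i j ^ 2 := by
    rw [Finset.sum_comm]
    rfl
  rw [h4] at h2
  have ha : 0 ≤ ∑ i, ∑ k, L i k ^ 2 := by positivity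
  have hb0 : 0 ≤ ∑ i, ∑ k, R i k ^ 2 := by positivity
  generalize (∑ i, ∑ k, L i k * (G * (G * R)ᵀ) k i) = S at *
  generalize (∑ i, ∑ k, L i k ^ 2) = a at *
  generalize (∑ i, ∑ k, R i k ^ 2) = b at *
  have h5 := h1.trans (mul_le_mul_of_nonneg_left
    (h2.trans (mul_le_mul_of_nonneg_left h3 (sq_nonneg σ))) ha)
  have hb : 0 ≤ a * b + σ ^ 4 := by positivity
  have hab : 0 ≤ σ ^ 4 * (a * b) := by nlinarith [sq_nonneg S]
  have h6 : 2 * S ≤ |a * b + σ ^ 4| := by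
    refine (le_abs_self _).trans (sq_le_sq.mp ?_)
    nlinarith [sq_nonneg (a * b - σ ^ 4)]
  rw [abs_of_nonneg hb] at h6
  nlinarith
end

section
/- Let F be a symmetric mn×mn real matrix admitting a decomposition F = A ⊗ B + E, where A is a symmetric m×m matrix, B is a symmetric n×n matrix, and E is an mn×mn matrix with ‖E‖_F ≤ ‖off(F)‖_F. Let Q_A be an m×m orthogonal matrix and Q_B an n×n orthogonal matrix such that Q_Aᵀ A Q_A and Q_Bᵀ B Q_B are diagonal matrices. Then ‖diag((Q_A ⊗ Q_B)ᵀ F (Q_A ⊗ Q_B))‖_F ≥ ‖diag(F)‖_F and ‖off((Q_A ⊗ Q_B)ᵀ F (Q_A ⊗ Q_B))‖_F ≤ ‖off(F)‖_F. -/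
open Matrix Kronecker BigOperators

/-- The diagonal part of a square matrix. -/
def diagPart {ι : Type*} [Fintype ι] [DecidableEq ι] (A : Matrix ι ι ℝ) : Matrix ι ι ℝ :=
  Matrix.diagonal (fun i => A i i)

/-- The off-diagonal part of a square matrix. -/
def offPart {ι : Type*} [Fintype ι] [DecidableEq ι] (A : Matrix ι ι ℝ) : Matrix ι ι ℝ :=
  A - diagPart A

/-- The squared Frobenius norm is the trace of `Xᵀ X`. -/
theorem sumSq_eq_trace {ι : Type*} [Fintype ι] (X : Matrix ι ι ℝ) :
    ∑ i, ∑ j, X i j ^ 2 = (Xᵀ * X).trace := by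
  rw [Finset.sum_comm]
  simp [Matrix.trace, Matrix.mul_apply, pow_two]

/-- The squared Frobenius norm is invariant under orthogonal conjugation. -/
theorem sumSq_conj {ι : Type*} [Fintype ι] [DecidableEq ι] (Q X : Matrix ι ι ℝ)
    (hQ : Qᵀ * Q = 1) :
    ∑ i, ∑ j, (Qᵀ * X * Q) i j ^ 2 = ∑ i, ∑ j, X i j ^ 2 := by
  have hQ' : Q * Qᵀ = 1 := mul_eq_one_comm.mp hQ
  rw [sumSq_eq_trace, sumSq_eq_trace]
  have h : (Qᵀ * X * Q)ᵀ * (Qᵀ * X * Q) = Qᵀ * (Xᵀ * (Q * Qᵀ) * X * Q) := by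
    simp only [Matrix.transpose_mul, Matrix.transpose_transpose, Matrix.mul_assoc]
  rw [h, hQ', Matrix.trace_mul_comm, Matrix.mul_assoc, Matrix.mul_assoc, hQ', Matrix.mul_one,
    Matrix.mul_one]

/-- Pythagoras for the diagonal and off-diagonal parts. -/
theorem sumSq_split {ι : Type*} [Fintype ι] [DecidableEq ι] (X : Matrix ι ι ℝ) :
    ∑ i, ∑ j, X i j ^ 2 =
      ∑ i, ∑ j, diagPart X i j ^ 2 + ∑ i, ∑ j, offPart X i j ^ 2 := by
  rw [← Finset.sum_add_distrib]
  refine Finset.sum_congr rfl fun i _ => ?_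
  rw [← Finset.sum_add_distrib]
  refine Finset.sum_congr rfl fun j _ => ?_
  by_cases h : i = j
  · subst h
    simp [offPart, diagPart]
  · simp [offPart, diagPart, Matrix.diagonal_apply_ne _ h]

theorem sumSq_nonneg {ι : Type*} [Fintype ι] (X : Matrix ι ι ℝ) :
    0 ≤ ∑ i, ∑ j, X i j ^ 2 :=
  Finset.sum_nonneg fun _ _ => Finset.sum_nonneg fun _ _ => sq_nonneg _

/-- rotating a symmetric matrix `F = A ⊗ B + E` (with `‖E‖_F ≤ ‖off(F)‖_F`)
by the Kronecker product of eigenbases of `A` and `B` makes it "more diagonal". -/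
theorem rotated_fisher_more_diagonal {m n : ℕ}
    (F : Matrix (Fin m × Fin n) (Fin m × Fin n) ℝ) (hFsymm : F.IsSymm)
    (A : Matrix (Fin m) (Fin m) ℝ) (hA : A.IsSymm)
    (B : Matrix (Fin n) (Fin n) ℝ) (hB : B.IsSymm)
    (E : Matrix (Fin m × Fin n) (Fin m × Fin n) ℝ)
    (hdecomp : F = A ⊗ₖ B + E)
    (hE : frobNorm E ≤ frobNorm (offPart F))
    (QA : Matrix (Fin m) (Fin m) ℝ) (hQA : QAᵀ * QA = 1) (hdA : (QAᵀ * A * QA).IsDiag)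
    (QB : Matrix (Fin n) (Fin n) ℝ) (hQB : QBᵀ * QB = 1) (hdB : (QBᵀ * B * QB).IsDiag) :
    frobNorm (diagPart ((QA ⊗ₖ QB)ᵀ * F * (QA ⊗ₖ QB))) ≥ frobNorm (diagPart F) ∧
    frobNorm (offPart ((QA ⊗ₖ QB)ᵀ * F * (QA ⊗ₖ QB))) ≤ frobNorm (offPart F) := by
  have hQ : (QA ⊗ₖ QB)ᵀ * (QA ⊗ₖ QB) = 1 := by
    rw [← Matrix.kroneckerMap_transpose, ← Matrix.mul_kronecker_mul, hQA, hQB,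
      Matrix.one_kronecker_one]
  have hD : ((QA ⊗ₖ QB)ᵀ * (A ⊗ₖ B) * (QA ⊗ₖ QB)).IsDiag := by
    rw [← Matrix.kroneckerMap_transpose, ← Matrix.mul_kronecker_mul, ← Matrix.mul_kronecker_mul]
    exact hdA.kronecker hdB
  have hoff : offPart ((QA ⊗ₖ QB)ᵀ * F * (QA ⊗ₖ QB)) =
      offPart ((QA ⊗ₖ QB)ᵀ * E * (QA ⊗ₖ QB)) := by
    rw [hdecomp, Matrix.mul_add, Matrix.add_mul]
    ext i j
    by_cases h : i = j
    · subst h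
      simp [offPart, diagPart]
    · simp only [offPart, diagPart, Matrix.sub_apply, Matrix.diagonal_apply_ne _ h,
        Matrix.add_apply, hD h, zero_add]
  have hE' : ∑ i, ∑ j, E i j ^ 2 ≤ ∑ i, ∑ j, offPart F i j ^ 2 :=
    (Real.sqrt_le_sqrt_iff (sumSq_nonneg _)).mp hE
  have h1 := sumSq_conj (QA ⊗ₖ QB) E hQ
  have h2 := sumSq_conj (QA ⊗ₖ QB) F hQ
  have h3 := sumSq_split ((QA ⊗ₖ QB)ᵀ * E * (QA ⊗ₖ QB))
  have h4 := sumSq_split ((QA ⊗ₖ QB)ᵀ * F * (QA ⊗ₖ QB))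
  have h5 := sumSq_split F
  have h6 := sumSq_nonneg (diagPart ((QA ⊗ₖ QB)ᵀ * E * (QA ⊗ₖ QB)))
  rw [hoff] at h4 ⊢
  constructor
  · exact Real.sqrt_le_sqrt (by linarith)
  · exact Real.sqrt_le_sqrt (by linarith)
end

section
/- For any real m×n matrix A and any real p×q matrix B, the ℓ2 operator norm (largest singular value) of their Kronecker product factorizes: ‖A ⊗ B‖₂ = ‖A‖₂ · ‖B‖₂, where ‖M‖₂ = sup_{x≠0} ‖M x‖ / ‖x‖ with Euclidean vector norms. -/
open Matrix Kronecker BigOperators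

/-- The ℓ2 operator norm of a matrix: `sup_{x ≠ 0} ‖M x‖ / ‖x‖` in Euclidean norms. -/
noncomputable def opNorm {a b : Type*} [Fintype a] [Fintype b] (M : Matrix a b ℝ) : ℝ :=
  sSup {c : ℝ | ∃ x, x ≠ 0 ∧ c = vnorm (M.mulVec x) / vnorm x}

theorem vnorm_nonneg' {ι : Type*} [Fintype ι] (x : ι → ℝ) : 0 ≤ vnorm x := Real.sqrt_nonneg _

theorem vnorm_sq' {ι : Type*} [Fintype ι] (x : ι → ℝ) : vnorm x ^ 2 = ∑ i, x i ^ 2 :=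
  Real.sq_sqrt (Finset.sum_nonneg fun _ _ => sq_nonneg _)

theorem vnorm_pos' {ι : Type*} [Fintype ι] {x : ι → ℝ} (hx : x ≠ 0) : 0 < vnorm x := by
  obtain ⟨i, hi⟩ := Function.ne_iff.mp hx
  apply Real.sqrt_pos.mpr
  exact Finset.sum_pos' (fun _ _ => sq_nonneg _) ⟨i, Finset.mem_univ _, by
    have : x i ≠ 0 := hi
    positivity⟩

theorem vnorm_zero' {ι : Type*} [Fintype ι] : vnorm (0 : ι → ℝ) = 0 := by
  simp [vnorm]

theorem opNorm_nonneg' {a b : Type*} [Fintype a] [Fintype b] (M : Matrix a b ℝ) :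
    0 ≤ opNorm M := by
  apply Real.sSup_nonneg
  rintro c ⟨x, _, rfl⟩
  exact div_nonneg (vnorm_nonneg' _) (vnorm_nonneg' _)

theorem opNorm_bdd' {a b : Type*} [Fintype a] [Fintype b] (M : Matrix a b ℝ) :
    BddAbove {c : ℝ | ∃ x, x ≠ 0 ∧ c = vnorm (M.mulVec x) / vnorm x} := by
  refine ⟨Real.sqrt (∑ i, ∑ j, M i j ^ 2), ?_⟩
  rintro c ⟨x, hx, rfl⟩
  rw [div_le_iff₀ (vnorm_pos' hx)]
  unfold vnorm
  have h0 : 0 ≤ ∑ i, ∑ j, M i j ^ 2 :=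
    Finset.sum_nonneg fun _ _ => Finset.sum_nonneg fun _ _ => sq_nonneg _
  rw [← Real.sqrt_mul h0]
  apply Real.sqrt_le_sqrt
  rw [Finset.sum_mul]
  refine Finset.sum_le_sum fun i _ => ?_
  exact Finset.sum_mul_sq_le_sq_mul_sq _ _ _

theorem le_opNorm' {a b : Type*} [Fintype a] [Fintype b] (M : Matrix a b ℝ) (x : b → ℝ) :
    vnorm (M.mulVec x) ≤ opNorm M * vnorm x := by
  by_cases hx : x = 0
  · subst hx
    simp [vnorm_zero']
  · rw [← div_le_iff₀ (vnorm_pos' hx)]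
    exact le_csSup (opNorm_bdd' M) ⟨x, hx, rfl⟩

theorem le_opNorm_sq' {a b : Type*} [Fintype a] [Fintype b] (M : Matrix a b ℝ) (x : b → ℝ) :
    ∑ i, (M.mulVec x i) ^ 2 ≤ opNorm M ^ 2 * ∑ j, x j ^ 2 := by
  rw [← vnorm_sq', ← vnorm_sq', ← mul_pow]
  exact pow_le_pow_left₀ (vnorm_nonneg' _) (le_opNorm' M x) 2

theorem mul_opNorm_le' {a b : Type*} [Fintype a] [Fintype b] (M : Matrix a b ℝ) {c D : ℝ}
    (hc : 0 ≤ c) (hD : 0 ≤ D) (h : ∀ x, c * vnorm (M.mulVec x) ≤ D * vnorm x) :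
    c * opNorm M ≤ D := by
  rcases hc.eq_or_lt with rfl | hc
  · simpa using hD
  rw [mul_comm, ← le_div_iff₀ hc]
  apply Real.sSup_le _ (by positivity)
  rintro _ ⟨x, hx, rfl⟩
  rw [div_le_div_iff₀ (vnorm_pos' hx) hc, mul_comm]
  exact h x

theorem kron_mulVec' {m n p q : ℕ}
    (A : Matrix (Fin m) (Fin n) ℝ) (B : Matrix (Fin p) (Fin q) ℝ) (x : Fin n × Fin q → ℝ)
    (i : Fin m) (k : Fin p) :
    (A ⊗ₖ B).mulVec x (i, k) = A.mulVec (fun j => B.mulVec (fun l => x (j, l)) k) i := by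
  simp only [Matrix.mulVec, dotProduct, Matrix.kroneckerMap_apply, Fintype.sum_prod_type,
    Finset.mul_sum, mul_assoc]

theorem vnorm_prod' {n q : ℕ} (x : Fin n → ℝ) (y : Fin q → ℝ) :
    vnorm (fun z : Fin n × Fin q => x z.1 * y z.2) = vnorm x * vnorm y := by
  unfold vnorm
  rw [← Real.sqrt_mul (Finset.sum_nonneg fun _ _ => sq_nonneg _), Fintype.sum_prod_type,
    Finset.sum_mul_sum]
  simp only [mul_pow]

/-- the ℓ2 operator norm of a Kronecker product factorizes. -/
theorem opNorm_kronecker {m n p q : ℕ}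
    (A : Matrix (Fin m) (Fin n) ℝ) (B : Matrix (Fin p) (Fin q) ℝ) :
    opNorm (A ⊗ₖ B) = opNorm A * opNorm B := by
  have hA := opNorm_nonneg' A
  have hB := opNorm_nonneg' B
  have hN := opNorm_nonneg' (A ⊗ₖ B)
  apply le_antisymm
  · rw [← one_mul (opNorm (A ⊗ₖ B))]
    refine mul_opNorm_le' _ zero_le_one (mul_nonneg hA hB) fun x => ?_
    rw [one_mul]
    refine (sq_le_sq₀ (vnorm_nonneg' _)
      (mul_nonneg (mul_nonneg hA hB) (vnorm_nonneg' _))).mp ?_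
    rw [mul_pow, mul_pow, vnorm_sq', vnorm_sq', Fintype.sum_prod_type, Fintype.sum_prod_type,
      Finset.sum_comm]
    simp only [kron_mulVec']
    calc _ ≤ ∑ k, opNorm A ^ 2 * ∑ j, (B.mulVec (fun l => x (j, l)) k) ^ 2 :=
          Finset.sum_le_sum fun k _ => le_opNorm_sq' A _
      _ = opNorm A ^ 2 * ∑ j, ∑ k, (B.mulVec (fun l => x (j, l)) k) ^ 2 := by
          rw [← Finset.mul_sum, Finset.sum_comm]
      _ ≤ opNorm A ^ 2 * ∑ j, opNorm B ^ 2 * ∑ l, x (j, l) ^ 2 := by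
          gcongr with j _
          exact le_opNorm_sq' B _
      _ = _ := by rw [← Finset.mul_sum, mul_assoc]
  · refine mul_opNorm_le' B hA hN fun y => ?_
    rw [mul_comm]
    refine mul_opNorm_le' A (vnorm_nonneg' _) (mul_nonneg hN (vnorm_nonneg' _)) fun x => ?_
    have h := le_opNorm' (A ⊗ₖ B) (fun z => x z.1 * y z.2)
    have e : (A ⊗ₖ B).mulVec (fun z => x z.1 * y z.2)
        = fun z => A.mulVec x z.1 * B.mulVec y z.2 := by
      ext ⟨i, k⟩
      simp only [Matrix.mulVec, dotProduct, Matrix.kroneckerMap_apply, Fintype.sum_prod_type,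
        Finset.sum_mul_sum]
      refine Finset.sum_congr rfl fun j _ => Finset.sum_congr rfl fun l _ => ?_
      ring
    rw [e, vnorm_prod', vnorm_prod'] at h
    linarith
end

section
/- Let ℓ_0 ∈ ℝ^p, r_0 ∈ ℝ^q, a ∈ ℝ^p, b ∈ ℝ^q be unit vectors with aᵀℓ_0 ≠ 0 and bᵀr_0 ≠ 0, and let s_0 > 0, s > 0. Set F_1 = s·a bᵀ and ΔF = F_1 − s_0 ℓ_0 r_0ᵀ. Define one step of the rank-one projector-splitting integrator: w = s_0 ℓ_0 + ΔF r_0 and ℓ_1 = w/‖w‖; z = s_0 r_0 + ΔFᵀ ℓ_0 and r_1 = z/‖z‖; s_1 = ℓ_1ᵀ F_1 r_1. Then w = s (bᵀr_0) a ≠ 0, z = s (aᵀℓ_0) b ≠ 0, and ℓ_1 s_1 r_1ᵀ = s·a bᵀ = F_1; that is, one projector-splitting step exactly reproduces a rank-one target matrix. -/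
open Matrix BigOperators

theorem vnorm_one_sum {n : ℕ} (x : Fin n → ℝ) (h : vnorm x = 1) : x ⬝ᵥ x = 1 := by
  unfold vnorm at h
  rw [Real.sqrt_eq_one] at h
  rw [← h]
  simp [dotProduct, pow_two]

theorem vnorm_smul_unit {n : ℕ} (c : ℝ) (x : Fin n → ℝ) (h : vnorm x = 1) :
    vnorm (c • x) = |c| := by
  unfold vnorm at *
  rw [Real.sqrt_eq_one] at h
  simp only [Pi.smul_apply, smul_eq_mul, mul_pow, ← Finset.mul_sum, h, mul_one, Real.sqrt_sq_eq_abs]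

theorem step_vec {p q : ℕ} (l a : Fin p → ℝ) (r b : Fin q → ℝ) (s s0 : ℝ) (hr : vnorm r = 1) :
    s0 • l + (s • vecMulVec a b - s0 • vecMulVec l r).mulVec r = (s * (∑ i, b i * r i)) • a := by
  have h := vnorm_one_sum r hr
  rw [Matrix.sub_mulVec, Matrix.smul_mulVec, Matrix.smul_mulVec, Matrix.vecMulVec_mulVec,
    Matrix.vecMulVec_mulVec, h]
  ext i
  simp [dotProduct]
  ring

theorem abs_inv_mul_sq (c : ℝ) (h : c ≠ 0) : (|c|⁻¹ * c) * (|c|⁻¹ * c) = 1 := by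
  have h2 : |c| ≠ 0 := abs_ne_zero.mpr h
  have h3 := abs_mul_abs_self c
  field_simp
  nlinarith

theorem ne_zero_of_unit {n : ℕ} (c : ℝ) (hc : c ≠ 0) (x : Fin n → ℝ) (h : vnorm x = 1) :
    c • x ≠ 0 := by
  refine smul_ne_zero hc ?_
  rintro rfl
  simp [vnorm] at h

/-- one step of the rank-one projector-splitting integrator exactly
reproduces a rank-one target matrix `F₁ = s a bᵀ`. -/
theorem projector_splitting_rank_one_exact {p q : ℕ}
    (ℓ0 : Fin p → ℝ) (r0 : Fin q → ℝ) (a : Fin p → ℝ) (b : Fin q → ℝ)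
    (hℓ0 : vnorm ℓ0 = 1) (hr0 : vnorm r0 = 1) (ha : vnorm a = 1) (hb : vnorm b = 1)
    (hal : (∑ i, a i * ℓ0 i) ≠ 0) (hbr : (∑ i, b i * r0 i) ≠ 0)
    (s0 s : ℝ) (hs0 : 0 < s0) (hs : 0 < s)
    (F1 : Matrix (Fin p) (Fin q) ℝ) (hF1 : F1 = s • vecMulVec a b)
    (ΔF : Matrix (Fin p) (Fin q) ℝ) (hΔF : ΔF = F1 - s0 • vecMulVec ℓ0 r0)
    (w : Fin p → ℝ) (hw : w = s0 • ℓ0 + ΔF.mulVec r0)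
    (ℓ1 : Fin p → ℝ) (hℓ1 : ℓ1 = (vnorm w)⁻¹ • w)
    (z : Fin q → ℝ) (hz : z = s0 • r0 + ΔFᵀ.mulVec ℓ0)
    (r1 : Fin q → ℝ) (hr1 : r1 = (vnorm z)⁻¹ • z)
    (s1 : ℝ) (hs1 : s1 = ℓ1 ⬝ᵥ F1.mulVec r1) :
    w = (s * (∑ i, b i * r0 i)) • a ∧ w ≠ 0 ∧
    z = (s * (∑ i, a i * ℓ0 i)) • b ∧ z ≠ 0 ∧
    s1 • vecMulVec ℓ1 r1 = F1 := by
  have hw' : w = (s * (∑ i, b i * r0 i)) • a := by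
    rw [hw, hΔF, hF1]
    exact step_vec ℓ0 a r0 b s s0 hr0
  have hz' : z = (s * (∑ i, a i * ℓ0 i)) • b := by
    rw [hz, hΔF, hF1, Matrix.transpose_sub, Matrix.transpose_smul, Matrix.transpose_smul,
      Matrix.transpose_vecMulVec, Matrix.transpose_vecMulVec]
    exact step_vec r0 b ℓ0 a s s0 hℓ0
  have hc := mul_ne_zero hs.ne' hbr
  have hd := mul_ne_zero hs.ne' hal
  refine ⟨hw', ?_, hz', ?_, ?_⟩
  · rw [hw']
    exact ne_zero_of_unit _ hc a ha
  · rw [hz']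
    exact ne_zero_of_unit _ hd b hb
  · rw [hw', vnorm_smul_unit _ _ ha, smul_smul] at hℓ1
    rw [hz', vnorm_smul_unit _ _ hb, smul_smul] at hr1
    have hc2 := abs_inv_mul_sq _ hc
    have hd2 := abs_inv_mul_sq _ hd
    generalize |s * ∑ i, b i * r0 i|⁻¹ * (s * ∑ i, b i * r0 i) = c at *
    generalize |s * ∑ i, a i * ℓ0 i|⁻¹ * (s * ∑ i, a i * ℓ0 i) = d at *
    have hs1' : s1 = s * c * d := by
      rw [hs1, hF1, hℓ1, hr1, Matrix.smul_mulVec, Matrix.vecMulVec_mulVec]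
      simp [vnorm_one_sum a ha, vnorm_one_sum b hb]
      ring
    rw [hs1', hF1, hℓ1, hr1]
    ext i j
    simp only [Matrix.smul_apply, Matrix.vecMulVec_apply, Pi.smul_apply, smul_eq_mul]
    linear_combination (s * a i * b j * d * d) * hc2 + (s * a i * b j) * hd2
end
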